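/- Let h_{ab} : ℝ⁴ → ℝ be smooth and symmetric, let ξ_a : ℝ⁴ → ℝ be smooth, and set h̃_{ab} := h_{ab} + ∂_a ξ_b + ∂_b ξ_a. With the null frame K = ∂_t − ∂_x, L = ∂_t + ∂_x, Q = ∂_y + i∂_z, ∇_v := v^a∂_a, and subscripts denoting contraction with frame vectors via ℂ-bilinear extension, the following identities hold at every point of ℝ⁴: (i) ∇_K h̃_{KK} = ∇_K h_{KK} + 2∇_K∇_K ξ_K; (ii) ∇_K h̃_{KQ} − ½∇_Q h̃_{KK} = ∇_K h_{KQ} − ½∇_Q h_{KK} + ∇_K∇_K ξ_Q; (iii) ∇_K h̃_{KL} − ½∇_L h̃_{KK} = ∇_K h_{KL} − ½∇_L h_{KK} + ∇_K∇_K ξ_L, where ξ_v := v^aξ_a. -/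

import Mathlib

noncomputable section

/-- Real partial derivative `∂_a f` on `ℝ⁴ = Fin 4 → ℝ`. -/
def pd (a : Fin 4) (f : (Fin 4 → ℝ) → ℝ) : (Fin 4 → ℝ) → ℝ :=
  fun x => fderiv ℝ f x (Pi.single a 1)

/-- Complex-valued partial derivative `∂_a f` on `ℝ⁴`. -/
def pdC (a : Fin 4) (f : (Fin 4 → ℝ) → ℂ) : (Fin 4 → ℝ) → ℂ :=
  fun x => fderiv ℝ f x (Pi.single a 1)

/-- Null frame vector `K = ∂_t − ∂_x`. -/
def Kv : Fin 4 → ℂ := ![1, -1, 0, 0]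
/-- Null frame vector `L = ∂_t + ∂_x`. -/
def Lv : Fin 4 → ℂ := ![1, 1, 0, 0]
/-- Null frame vector `Q = ∂_y + i ∂_z`. -/
def Qv : Fin 4 → ℂ := ![0, 0, 1, Complex.I]

/-- Directional derivative `∇_v f = v^a ∂_a f` (ℂ-bilinear extension). -/
def nab (v : Fin 4 → ℂ) (f : (Fin 4 → ℝ) → ℂ) : (Fin 4 → ℝ) → ℂ :=
  fun x => ∑ a, v a * pdC a f x

/-- Frame contraction `h_{vw} = v^a w^b h_{ab}` (ℂ-bilinear extension). -/
def contr2 (h : Fin 4 → Fin 4 → (Fin 4 → ℝ) → ℝ) (v w : Fin 4 → ℂ) :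
    (Fin 4 → ℝ) → ℂ :=
  fun x => ∑ a, ∑ b, v a * w b * (h a b x : ℂ)

/-- Frame contraction `ξ_v = v^a ξ_a` (ℂ-bilinear extension). -/
def contr1 (ξ : Fin 4 → (Fin 4 → ℝ) → ℝ) (v : Fin 4 → ℂ) : (Fin 4 → ℝ) → ℂ :=
  fun x => ∑ a, v a * (ξ a x : ℂ)

theorem pd_smooth (a : Fin 4) {f : (Fin 4 → ℝ) → ℝ} (hf : ContDiff ℝ (⊤ : ℕ∞) f) :
    ContDiff ℝ (⊤ : ℕ∞) (pd a f) := by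
  unfold pd
  exact (hf.fderiv_right (m := (⊤ : ℕ∞)) (by simp)).clm_apply contDiff_const

theorem pd_comm (a b : Fin 4) {f : (Fin 4 → ℝ) → ℝ} (hf : ContDiff ℝ (⊤ : ℕ∞) f)
    (x : Fin 4 → ℝ) : pd a (pd b f) x = pd b (pd a f) x := by
  have hd : DifferentiableAt ℝ (fderiv ℝ f) x :=
    ((hf.fderiv_right (m := (⊤ : ℕ∞)) (by simp)).differentiable (by simp)) x
  have key : ∀ c d : Fin 4, pd c (pd d f) x
      = fderiv ℝ (fderiv ℝ f) x (Pi.single c 1) (Pi.single d 1) := by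
    intro c d
    unfold pd
    rw [fderiv_clm_apply hd (differentiableAt_const _)]
    simp
  rw [key, key]
  have hs : IsSymmSndFDerivAt ℝ f x :=
    hf.contDiffAt.isSymmSndFDerivAt (by
      rw [minSmoothness_of_isRCLikeNormedField]
      exact WithTop.coe_le_coe.2 (le_top : (2 : ℕ∞) ≤ ⊤))
  exact hs _ _

theorem hasFDerivAt_term (k : ℂ) {f : (Fin 4 → ℝ) → ℝ} (hf : ContDiff ℝ (⊤ : ℕ∞) f)
    (x : Fin 4 → ℝ) : HasFDerivAt (fun y => k * (f y : ℂ))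
      (k • (Complex.ofRealCLM.comp (fderiv ℝ f x))) x := by
  have h1 : HasFDerivAt f (fderiv ℝ f x) x :=
    (hf.differentiable (by simp) x).hasFDerivAt
  exact (Complex.ofRealCLM.hasFDerivAt.comp x h1).const_mul k

theorem pdC_contr2 (c : Fin 4) {h : Fin 4 → Fin 4 → (Fin 4 → ℝ) → ℝ}
    (hh : ∀ a b, ContDiff ℝ (⊤ : ℕ∞) (h a b)) (v w : Fin 4 → ℂ) (x : Fin 4 → ℝ) :
    pdC c (contr2 h v w) x = ∑ a, ∑ b, v a * w b * (pd c (h a b) x : ℂ) := by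
  have H : HasFDerivAt (contr2 h v w)
      (∑ a, ∑ b, (v a * w b) • (Complex.ofRealCLM.comp (fderiv ℝ (h a b) x))) x := by
    unfold contr2
    exact HasFDerivAt.fun_sum fun a _ => HasFDerivAt.fun_sum fun b _ =>
      hasFDerivAt_term _ (hh a b) x
  unfold pdC
  rw [H.fderiv]
  simp [pd]

theorem nab_contr1 {ξ : Fin 4 → (Fin 4 → ℝ) → ℝ}
    (hξ : ∀ a, ContDiff ℝ (⊤ : ℕ∞) (ξ a)) (v w : Fin 4 → ℂ) :
    nab v (contr1 ξ w) = contr2 (fun a b => pd a (ξ b)) v w := by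
  funext x
  have H : HasFDerivAt (contr1 ξ w)
      (∑ b, (w b) • (Complex.ofRealCLM.comp (fderiv ℝ (ξ b) x))) x := by
    unfold contr1
    exact HasFDerivAt.fun_sum fun b _ => hasFDerivAt_term _ (hξ b) x
  unfold nab pdC contr2
  rw [H.fderiv]
  simp [pd, Finset.mul_sum, mul_assoc]

theorem nab_contr2_gauge {h ht : Fin 4 → Fin 4 → (Fin 4 → ℝ) → ℝ}
    (hh : ∀ a b, ContDiff ℝ (⊤ : ℕ∞) (h a b))
    {ξ : Fin 4 → (Fin 4 → ℝ) → ℝ} (hξ : ∀ a, ContDiff ℝ (⊤ : ℕ∞) (ξ a))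
    (hht : ∀ a b x, ht a b x = h a b x + pd a (ξ b) x + pd b (ξ a) x)
    (u v w : Fin 4 → ℂ) (x : Fin 4 → ℝ) :
    nab u (contr2 ht v w) x = nab u (contr2 h v w) x
      + nab u (nab v (contr1 ξ w)) x + nab u (nab w (contr1 ξ v)) x := by
  have e : ht = fun a b x => h a b x + pd a (ξ b) x + pd b (ξ a) x := by
    funext a b x; exact hht a b x
  have hp : ∀ a b, ContDiff ℝ (⊤ : ℕ∞) (pd a (ξ b)) := fun a b => pd_smooth a (hξ b)
  have hts : ∀ a b, ContDiff ℝ (⊤ : ℕ∞) (ht a b) := by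
    intro a b
    rw [e]
    exact ((hh a b).add (hp a b)).add (hp b a)
  have hpd : ∀ c a b, pd c (ht a b) x
      = pd c (h a b) x + pd c (pd a (ξ b)) x + pd c (pd b (ξ a)) x := by
    intro c a b
    have d : ∀ {f : (Fin 4 → ℝ) → ℝ}, ContDiff ℝ (⊤ : ℕ∞) f →
        HasFDerivAt f (fderiv ℝ f x) x := fun hf =>
      (hf.differentiable (by simp) x).hasFDerivAt
    have H : HasFDerivAt (ht a b)
        (fderiv ℝ (h a b) x + fderiv ℝ (pd a (ξ b)) x + fderiv ℝ (pd b (ξ a)) x) x := by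
      rw [e]
      exact ((d (hh a b)).add (d (hp a b))).add (d (hp b a))
    unfold pd at H ⊢
    rw [H.fderiv]
    rfl
  rw [nab_contr1 hξ, nab_contr1 hξ]
  unfold nab
  simp only [pdC_contr2 _ hts, pdC_contr2 _ hh, pdC_contr2 _ hp, hpd]
  rw [← Finset.sum_add_distrib, ← Finset.sum_add_distrib]
  refine Finset.sum_congr rfl fun c _ => ?_
  rw [← mul_add, ← mul_add]
  congr 1
  rw [Finset.sum_comm (f := fun a b => w a * v b * ((pd c (pd a (ξ b)) x : ℝ) : ℂ))]
  simp only [← Finset.sum_add_distrib]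
  refine Finset.sum_congr rfl fun a _ => Finset.sum_congr rfl fun b _ => ?_
  push_cast
  ring

theorem nab_nab_comm {ξ : Fin 4 → (Fin 4 → ℝ) → ℝ} (hξ : ∀ a, ContDiff ℝ (⊤ : ℕ∞) (ξ a))
    (u v w : Fin 4 → ℂ) (x : Fin 4 → ℝ) :
    nab u (nab v (contr1 ξ w)) x = nab v (nab u (contr1 ξ w)) x := by
  have hp : ∀ a b, ContDiff ℝ (⊤ : ℕ∞) (pd a (ξ b)) := fun a b => pd_smooth a (hξ b)
  rw [nab_contr1 hξ, nab_contr1 hξ]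
  unfold nab
  simp only [pdC_contr2 _ hp, Finset.mul_sum]
  rw [Finset.sum_comm]
  refine Finset.sum_congr rfl fun a _ => Finset.sum_congr rfl fun c _ =>
    Finset.sum_congr rfl fun b _ => ?_
  rw [pd_comm c a (hξ b)]
  ring

/-- Under the infinitesimal coordinate transformation `h̃_{ab} = h_{ab} + ∂_a ξ_b + ∂_b ξ_a`,
the gauge boundary data transform as
(i) `∇_K h̃_{KK} = ∇_K h_{KK} + 2∇_K∇_K ξ_K`;
(ii) `∇_K h̃_{KQ} − ½∇_Q h̃_{KK} = ∇_K h_{KQ} − ½∇_Q h_{KK} + ∇_K∇_K ξ_Q`;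
(iii) `∇_K h̃_{KL} − ½∇_L h̃_{KK} = ∇_K h_{KL} − ½∇_L h_{KK} + ∇_K∇_K ξ_L`. -/
theorem gauge_boundary_data_transformation
    (h : Fin 4 → Fin 4 → (Fin 4 → ℝ) → ℝ)
    (hsmooth : ∀ a b, ContDiff ℝ (⊤ : ℕ∞) (h a b))
    (hsymm : ∀ a b x, h a b x = h b a x)
    (ξ : Fin 4 → (Fin 4 → ℝ) → ℝ) (hξ : ∀ a, ContDiff ℝ (⊤ : ℕ∞) (ξ a))
    (ht : Fin 4 → Fin 4 → (Fin 4 → ℝ) → ℝ)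
    (hht : ∀ a b x, ht a b x = h a b x + pd a (ξ b) x + pd b (ξ a) x) :
    ∀ x : Fin 4 → ℝ,
      (nab Kv (contr2 ht Kv Kv) x
        = nab Kv (contr2 h Kv Kv) x + 2 * nab Kv (nab Kv (contr1 ξ Kv)) x) ∧
      (nab Kv (contr2 ht Kv Qv) x - (1/2) * nab Qv (contr2 ht Kv Kv) x
        = nab Kv (contr2 h Kv Qv) x - (1/2) * nab Qv (contr2 h Kv Kv) x
          + nab Kv (nab Kv (contr1 ξ Qv)) x) ∧
      (nab Kv (contr2 ht Kv Lv) x - (1/2) * nab Lv (contr2 ht Kv Kv) x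
        = nab Kv (contr2 h Kv Lv) x - (1/2) * nab Lv (contr2 h Kv Kv) x
          + nab Kv (nab Kv (contr1 ξ Lv)) x) := by
  intro x
  have G := nab_contr2_gauge hsmooth hξ hht
  refine ⟨?_, ?_, ?_⟩
  · rw [G]; ring
  · rw [G, G, nab_nab_comm hξ Qv Kv Kv]; ring
  · rw [G, G, nab_nab_comm hξ Lv Kv Kv]; ring

end
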